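/- arXiv:2006.03459 — 7 statements merged into one kernel-verified Lean document; each statement's English description precedes it below -/
import Mathlib

section
/- Let μ ∈ ℝ and σ_u, σ_v > 0, and set a = μ√(σ_v²+σ_u²)/(σ_v σ_u), b = −σ_u/σ_v. Then for every κ ∈ ℝ, ∫_{−∞}^{κ} f(t) dt = (1/Φ(μ/σ_u)) · ∫_{−∞}^{(κ+μ)/√(σ_v²+σ_u²)} φ(y) Φ(a + b y) dy, where f is the truncated-normal composed error density. -/
open Real MeasureTheory

/-- Standard normal density. -/
noncomputable def stdNormalPdf (x : ℝ) : ℝ := Real.exp (-x ^ 2 / 2) / Real.sqrt (2 * Real.pi)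

/-- Standard normal cumulative distribution function. -/
noncomputable def stdNormalCdf (x : ℝ) : ℝ := ∫ t in Set.Iic x, stdNormalPdf t

/-- Truncated-normal composed error density. -/
noncomputable def tnComposedErrorPdf (μ σu σv t : ℝ) : ℝ :=
  (1 / (Real.sqrt (σv ^ 2 + σu ^ 2) * stdNormalCdf (μ / σu))) *
    stdNormalPdf ((t + μ) / Real.sqrt (σv ^ 2 + σu ^ 2)) *
    stdNormalCdf ((μ * σv ^ 2 - t * σu ^ 2) / (Real.sqrt (σv ^ 2 + σu ^ 2) * σv * σu))

theorem integral_Iic_comp_add_div (g : ℝ → ℝ) (m κ : ℝ) {s : ℝ} (hs : 0 < s) :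
    (∫ t in Set.Iic κ, g ((t + m) / s)) = s * ∫ y in Set.Iic ((κ + m) / s), g y := by
  rw [← integral_indicator measurableSet_Iic, ← integral_indicator measurableSet_Iic]
  have hcomp : ∀ t, (Set.Iic κ).indicator (fun t => g ((t + m) / s)) t =
      (Set.Iic ((κ + m) / s)).indicator g ((t + m) / s) := by
    intro t
    simp only [Set.indicator_apply, Set.mem_Iic, div_le_div_iff_of_pos_right hs,
      add_le_add_iff_right]
  simp_rw [hcomp]
  rw [integral_add_right_eq_self (fun t => (Set.Iic ((κ + m) / s)).indicator g (t / s)) m,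
    Measure.integral_comp_div, abs_of_pos hs, smul_eq_mul]

theorem stmt0 (μ σu σv : ℝ) (hσu : 0 < σu) (hσv : 0 < σv)
    (a b : ℝ) (ha : a = μ * Real.sqrt (σv ^ 2 + σu ^ 2) / (σv * σu)) (hb : b = -(σu / σv))
    (κ : ℝ) :
    (∫ t in Set.Iic κ, tnComposedErrorPdf μ σu σv t) =
      (1 / stdNormalCdf (μ / σu)) *
        ∫ y in Set.Iic ((κ + μ) / Real.sqrt (σv ^ 2 + σu ^ 2)),
          stdNormalPdf y * stdNormalCdf (a + b * y) := by
  have hs : 0 < Real.sqrt (σv ^ 2 + σu ^ 2) := by positivity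
  have hsq : Real.sqrt (σv ^ 2 + σu ^ 2) ^ 2 = σv ^ 2 + σu ^ 2 := Real.sq_sqrt (by positivity)
  unfold tnComposedErrorPdf
  generalize Real.sqrt (σv ^ 2 + σu ^ 2) = s at *
  have harg : ∀ t, (μ * σv ^ 2 - t * σu ^ 2) / (s * σv * σu) = a + b * ((t + μ) / s) := by
    intro t
    rw [ha, hb]
    field_simp
    rw [hsq]
    ring
  simp_rw [harg, mul_assoc]
  rw [integral_const_mul,
    integral_Iic_comp_add_div (fun y => stdNormalPdf y * stdNormalCdf (a + b * y)) μ κ hs,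
    ← mul_assoc, one_div, one_div, mul_inv, mul_right_comm s⁻¹, inv_mul_cancel₀ hs.ne', one_mul]
end

section
/- Let μ ∈ ℝ with μ ≠ 0 and σ_u, σ_v > 0, and set a = μ√(σ_v²+σ_u²)/(σ_v σ_u), b = −σ_u/σ_v, and y(κ) = (κ+μ)/√(σ_v²+σ_u²). Then for every κ ∈ ℝ with κ ≠ −μ, ∫_{−∞}^{κ} f(t) dt = (1/Φ(μ/σ_u)) · [ ½Φ(y(κ)) + ½Φ(a/√(1+b²)) − ½·1{ a/(y(κ)√(1+b²)) < 0 } − T(y(κ), (a + b·y(κ))/y(κ)) − T(a/√(1+b²), (ab + y(κ)(1+b²))/a) ], where f is the truncated-normal composed error density and T is Owen's T function. -/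
open Real MeasureTheory

/-- Owen's T function. -/
noncomputable def owenT (h g : ℝ) : ℝ :=
  (1 / (2 * Real.pi)) * ∫ t in (0:ℝ)..g, Real.exp (-h ^ 2 * (1 + t ^ 2) / 2) / (1 + t ^ 2)

open Filter Topology

lemma stdNormalPdf_eq (x : ℝ) :
    stdNormalPdf x = (Real.sqrt (2 * π))⁻¹ * Real.exp (-(1 / 2) * x ^ 2) := by
  rw [stdNormalPdf, div_eq_inv_mul]
  congr 2
  ring

lemma continuous_stdNormalPdf : Continuous stdNormalPdf := by
  unfold stdNormalPdf
  fun_prop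

lemma stdNormalPdf_nonneg (x : ℝ) : 0 ≤ stdNormalPdf x := by
  unfold stdNormalPdf
  positivity

lemma integrable_stdNormalPdf : Integrable stdNormalPdf := by
  have h := (integrable_exp_neg_mul_sq (b := 1 / 2) (by norm_num)).const_mul
    (Real.sqrt (2 * π))⁻¹
  exact h.congr (ae_of_all _ fun x => (stdNormalPdf_eq x).symm)

lemma integral_stdNormalPdf : ∫ x, stdNormalPdf x = 1 := by
  simp_rw [stdNormalPdf_eq]
  rw [integral_const_mul, integral_gaussian]
  have : π / (1 / 2) = 2 * π := by ring
  rw [this, inv_mul_cancel₀]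
  positivity

lemma stdNormalCdf_nonneg (x : ℝ) : 0 ≤ stdNormalCdf x :=
  integral_nonneg stdNormalPdf_nonneg

lemma stdNormalCdf_le_one (x : ℝ) : stdNormalCdf x ≤ 1 := by
  rw [← integral_stdNormalPdf]
  exact setIntegral_le_integral integrable_stdNormalPdf (ae_of_all _ stdNormalPdf_nonneg)

lemma stdNormalCdf_zero : stdNormalCdf 0 = 1 / 2 := by
  have hneg : ∫ t in Set.Ioi (0 : ℝ), stdNormalPdf t = stdNormalCdf 0 := by
    have h := integral_comp_neg_Iic (0 : ℝ) stdNormalPdf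
    rw [neg_zero] at h
    rw [← h, stdNormalCdf]
    simp [stdNormalPdf]
  have hsum := intervalIntegral.integral_Iic_add_Ioi (b := (0 : ℝ))
    integrable_stdNormalPdf.integrableOn integrable_stdNormalPdf.integrableOn
  rw [hneg, integral_stdNormalPdf, ← stdNormalCdf] at hsum
  linarith

lemma integral_stdNormalPdf_interval (x y : ℝ) :
    ∫ t in x..y, stdNormalPdf t = stdNormalCdf y - stdNormalCdf x :=
  (intervalIntegral.integral_Iic_sub_Iic integrable_stdNormalPdf.integrableOn
    integrable_stdNormalPdf.integrableOn).symm

lemma hasDerivAt_stdNormalCdf (x : ℝ) : HasDerivAt stdNormalCdf (stdNormalPdf x) x := by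
  have h := (continuous_stdNormalPdf.integral_hasStrictDerivAt 0 x).hasDerivAt
  simp_rw [integral_stdNormalPdf_interval] at h
  simpa using h.add_const (stdNormalCdf 0)

lemma continuous_stdNormalCdf : Continuous stdNormalCdf :=
  continuous_iff_continuousAt.2 fun x => (hasDerivAt_stdNormalCdf x).continuousAt

lemma tendsto_stdNormalCdf_atBot : Tendsto stdNormalCdf atBot (𝓝 0) := by
  have h := intervalIntegral_tendsto_integral_Iic (0 : ℝ)
    integrable_stdNormalPdf.integrableOn tendsto_id
  simp_rw [integral_stdNormalPdf_interval] at h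
  rw [← stdNormalCdf] at h
  simpa using h.const_sub (stdNormalCdf 0)

lemma continuous_owenT_integrand (h : ℝ) :
    Continuous fun t : ℝ => Real.exp (-h ^ 2 * (1 + t ^ 2) / 2) / (1 + t ^ 2) :=
  Continuous.div (by fun_prop) (by fun_prop) fun t => by positivity

lemma hasDerivAt_owenT_right (h g : ℝ) :
    HasDerivAt (fun g => owenT h g)
      (Real.exp (-h ^ 2 * (1 + g ^ 2) / 2) / (1 + g ^ 2) / (2 * π)) g := by
  have := ((continuous_owenT_integrand h).integral_hasStrictDerivAt 0 g).hasDerivAt.const_mul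
    (1 / (2 * π))
  simp only [owenT]
  convert! this using 1
  ring

lemma hasDerivAt_owenT_left (h g : ℝ) :
    HasDerivAt (fun h => owenT h g) (-(stdNormalPdf h * (stdNormalCdf (g * h) - 1 / 2))) h := by
  have key := (intervalIntegral.hasDerivAt_integral_of_dominated_loc_of_deriv_le
    (μ := volume) (a := 0) (b := g)
    (F := fun h t : ℝ => Real.exp (-h ^ 2 * (1 + t ^ 2) / 2) / (1 + t ^ 2))
    (F' := fun h t : ℝ => -h * Real.exp (-h ^ 2 * (1 + t ^ 2) / 2))
    (x₀ := h) (s := Metric.ball h 1) (bound := fun _ => |h| + 1)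
    (Metric.ball_mem_nhds h one_pos)
    (Eventually.of_forall fun x => (continuous_owenT_integrand x).aestronglyMeasurable)
    ((continuous_owenT_integrand h).intervalIntegrable _ _)
    (Continuous.aestronglyMeasurable (by fun_prop)) ?_ (by simp) ?_).2.const_mul (1 / (2 * π))
  · simp only [owenT]
    convert! key using 1
    rw [← stdNormalCdf_zero, ← integral_stdNormalPdf_interval]
    have hs := intervalIntegral.mul_integral_comp_mul_left (a := 0) (b := g)
      (f := stdNormalPdf) h
    rw [mul_zero, mul_comm h g] at hs
    rw [← hs, ← intervalIntegral.integral_const_mul, ← intervalIntegral.integral_const_mul,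
      ← intervalIntegral.integral_neg, ← intervalIntegral.integral_const_mul]
    congr 1
    ext t
    have h2 : Real.sqrt (2 * π) * Real.sqrt (2 * π) = 2 * π :=
      Real.mul_self_sqrt (by positivity)
    have he : Real.exp (-h ^ 2 * (1 + t ^ 2) / 2)
        = Real.exp (-h ^ 2 / 2) * Real.exp (-(h * t) ^ 2 / 2) := by
      rw [← Real.exp_add]
      ring_nf
    rw [he, ← h2]
    simp only [stdNormalPdf]
    field_simp
  · refine ae_of_all _ fun t _ x hx => ?_
    rw [Metric.mem_ball, Real.dist_eq] at hx
    have h1 : |x| ≤ |h| + 1 := by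
      have := abs_sub_abs_le_abs_sub x h
      linarith
    have h2 : Real.exp (-x ^ 2 * (1 + t ^ 2) / 2) ≤ 1 := by
      rw [Real.exp_le_one_iff]
      have : 0 ≤ x ^ 2 * (1 + t ^ 2) := by positivity
      linarith
    rw [Real.norm_eq_abs, abs_mul, abs_neg, Real.abs_exp]
    exact (mul_le_of_le_one_right (abs_nonneg x) h2).trans h1
  · refine ae_of_all _ fun t _ x _ => ?_
    have h1 : HasDerivAt (fun x : ℝ => -x ^ 2 * (1 + t ^ 2) / 2) (-x * (1 + t ^ 2)) x := by
      have := ((hasDerivAt_pow 2 x).fun_neg.mul_const (1 + t ^ 2)).div_const 2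
      refine this.congr_deriv ?_
      norm_num
      ring
    refine (h1.exp.div_const (1 + t ^ 2)).congr_deriv ?_
    have : 1 + t ^ 2 ≠ 0 := by positivity
    field_simp

lemma HasDerivAt.owenT {p q : ℝ → ℝ} {p' q' x : ℝ} (hp : HasDerivAt p p' x)
    (hq : HasDerivAt q q' x) :
    HasDerivAt (fun y => owenT (p y) (q y))
      (-(stdNormalPdf (p x) * (stdNormalCdf (q x * p x) - 1 / 2)) * p'
        + Real.exp (-p x ^ 2 * (1 + q x ^ 2) / 2) / (1 + q x ^ 2) / (2 * π) * q') x := by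
  have hφ := continuous_stdNormalPdf
  have hΦ := continuous_stdNormalCdf
  have key := hasStrictFDerivAt_uncurry_coprod (𝕜 := ℝ) (u := (p x, q x)) (f := _root_.owenT)
    (f₁ := fun h g => ContinuousLinearMap.toSpanSingleton ℝ
      (-(stdNormalPdf h * (stdNormalCdf (g * h) - 1 / 2))))
    (f₂ := fun h g => ContinuousLinearMap.toSpanSingleton ℝ
      (Real.exp (-h ^ 2 * (1 + g ^ 2) / 2) / (1 + g ^ 2) / (2 * π)))
    (Eventually.of_forall fun v => (hasDerivAt_owenT_left v.1 v.2).hasFDerivAt)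
    (Eventually.of_forall fun v => (hasDerivAt_owenT_right v.1 v.2).hasFDerivAt)
    ?_ ?_
  · have := key.hasFDerivAt.comp_hasDerivAt x (hp.prodMk hq)
    refine this.congr_deriv ?_
    simp [Function.HasUncurry.uncurry]
    ring
  · refine ContinuousAt.comp (g := ContinuousLinearMap.toSpanSingletonCLE (𝕜 := ℝ) (E := ℝ))
      (f := fun v : ℝ × ℝ => -(stdNormalPdf v.1 * (stdNormalCdf (v.2 * v.1) - 1 / 2)))
      (ContinuousLinearEquiv.continuous _).continuousAt ?_
    fun_prop
  · refine ContinuousAt.comp (g := ContinuousLinearMap.toSpanSingletonCLE (𝕜 := ℝ) (E := ℝ))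
      (f := fun v : ℝ × ℝ => Real.exp (-v.1 ^ 2 * (1 + v.2 ^ 2) / 2) / (1 + v.2 ^ 2) / (2 * π))
      (ContinuousLinearEquiv.continuous _).continuousAt ?_
    have h1 : ∀ v : ℝ × ℝ, 1 + v.2 ^ 2 ≠ 0 := fun v => by positivity
    exact (((by fun_prop : Continuous fun v : ℝ × ℝ =>
      Real.exp (-v.1 ^ 2 * (1 + v.2 ^ 2) / 2)).div (by fun_prop) h1).div_const _).continuousAt

lemma abs_owenT_le (h g : ℝ) : |owenT h g| ≤ Real.exp (-h ^ 2 / 2) * |g| := by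
  have hb : ‖∫ t in (0 : ℝ)..g, Real.exp (-h ^ 2 * (1 + t ^ 2) / 2) / (1 + t ^ 2)‖
      ≤ Real.exp (-h ^ 2 / 2) * |g - 0| := by
    refine intervalIntegral.norm_integral_le_of_norm_le_const fun t _ => ?_
    rw [Real.norm_of_nonneg (by positivity)]
    refine (div_le_self (Real.exp_pos _).le (by nlinarith [sq_nonneg t])).trans ?_
    rw [Real.exp_le_exp]
    nlinarith [mul_nonneg (sq_nonneg h) (sq_nonneg t)]
  rw [sub_zero, Real.norm_eq_abs] at hb
  rw [owenT, abs_mul, abs_of_nonneg (by positivity)]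
  refine (mul_le_of_le_one_left (abs_nonneg _) ?_).trans hb
  rw [div_le_one (by positivity)]
  linarith [Real.pi_gt_three]

lemma owenT_zero_left (g : ℝ) : owenT 0 g = Real.arctan g / (2 * π) := by
  simp [owenT, integral_inv_one_add_sq]
  ring

/-- The reflection formula relating `T(h, g)` and `T(gh, 1/g)`. -/
lemma owenT_add_owenT_inv (h : ℝ) {g : ℝ} (hg : g ≠ 0) :
    owenT h g + owenT (g * h) g⁻¹ =
      stdNormalCdf h / 2 + stdNormalCdf (g * h) / 2 - stdNormalCdf h * stdNormalCdf (g * h)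
        - (if g < 0 then 1 else 0) / 2 := by
  set D : ℝ → ℝ := fun h => owenT h g + owenT (g * h) g⁻¹ - (stdNormalCdf h / 2
    + stdNormalCdf (g * h) / 2 - stdNormalCdf h * stdNormalCdf (g * h)) with hD
  have hderiv : ∀ h, HasDerivAt D 0 h := fun h => by
    have hlin : HasDerivAt (fun h => g * h) g h := by
      simpa using (hasDerivAt_id h).const_mul g
    have h1 := hasDerivAt_owenT_left h g
    have h2 := (hasDerivAt_owenT_left (g * h) g⁻¹).comp h hlin
    have h3 := hasDerivAt_stdNormalCdf h
    have h4 := (hasDerivAt_stdNormalCdf (g * h)).comp h hlin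
    rw [inv_mul_cancel_left₀ hg] at h2
    refine ((h1.fun_add h2).fun_sub (((h3.div_const 2).fun_add (h4.div_const 2)).fun_sub
      (h3.fun_mul h4))).congr_deriv ?_
    simp only [Function.comp_apply]
    ring
  have hconst := is_const_of_deriv_eq_zero (fun h => (hderiv h).differentiableAt)
    (fun h => (hderiv h).deriv) h 0
  simp only [hD, mul_zero, owenT_zero_left, stdNormalCdf_zero] at hconst
  split_ifs with hneg
  · have hsum : Real.arctan g / (2 * π) + (-(π / 2) - Real.arctan g) / (2 * π) = -1 / 4 := by
      field_simp
      ring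
    rw [Real.arctan_inv_of_neg hneg, hsum] at hconst
    linarith
  · have hsum : Real.arctan g / (2 * π) + (π / 2 - Real.arctan g) / (2 * π) = 1 / 4 := by
      field_simp
      ring
    rw [Real.arctan_inv_of_pos (lt_of_le_of_ne (not_lt.1 hneg) hg.symm), hsum] at hconst
    linarith

/-- Owen's closed form for `∫_{-∞}^y φ(x) Φ(a + b x) dx`, valid for `a ≠ 0` and `y ≠ 0`. -/
noncomputable def owenPrimitive (a b y : ℝ) : ℝ :=
  stdNormalCdf y / 2 + stdNormalCdf (a / Real.sqrt (1 + b ^ 2)) / 2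
    - (if a * y < 0 then 1 else 0) / 2 - owenT y ((a + b * y) / y)
    - owenT (a / Real.sqrt (1 + b ^ 2)) ((a * b + y * (1 + b ^ 2)) / a)

/-- The form of `owenPrimitive` obtained by reflecting its first `T` term; it is regular at `0`. -/
noncomputable def reflectedOwenPrimitive (a b y : ℝ) : ℝ :=
  stdNormalCdf (a / Real.sqrt (1 + b ^ 2)) / 2 - stdNormalCdf (a + b * y) / 2
    + stdNormalCdf y * stdNormalCdf (a + b * y) + owenT (a + b * y) (y / (a + b * y))
    - owenT (a / Real.sqrt (1 + b ^ 2)) ((a * b + y * (1 + b ^ 2)) / a)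

lemma hasDerivAt_affine (a b y : ℝ) : HasDerivAt (fun y => a + b * y) b y := by
  simpa using ((hasDerivAt_id y).const_mul b).const_add a

lemma hasDerivAt_owenT_shift {a : ℝ} (b y : ℝ) (ha : a ≠ 0) :
    HasDerivAt (fun y => owenT (a / Real.sqrt (1 + b ^ 2)) ((a * b + y * (1 + b ^ 2)) / a))
      (a * Real.exp (-(y ^ 2 + (a + b * y) ^ 2) / 2) / (y ^ 2 + (a + b * y) ^ 2) / (2 * π)) y := by
  have hb : 0 < 1 + b ^ 2 := by positivity
  have hlin : HasDerivAt (fun y => (a * b + y * (1 + b ^ 2)) / a) ((1 + b ^ 2) / a) y := by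
    have := (((hasDerivAt_id y).mul_const (1 + b ^ 2)).const_add (a * b)).div_const a
    simpa using this
  refine ((hasDerivAt_const y (a / Real.sqrt (1 + b ^ 2))).owenT hlin).congr_deriv ?_
  have hsq : (a / Real.sqrt (1 + b ^ 2)) ^ 2 = a ^ 2 / (1 + b ^ 2) := by
    rw [div_pow, Real.sq_sqrt hb.le]
  have hquad : 1 + ((a * b + y * (1 + b ^ 2)) / a) ^ 2
      = (1 + b ^ 2) * (y ^ 2 + (a + b * y) ^ 2) / a ^ 2 := by
    field_simp
    ring
  have hne : y ^ 2 + (a + b * y) ^ 2 ≠ 0 := by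
    intro h
    have hy : y = 0 := by nlinarith [sq_nonneg y, sq_nonneg (a + b * y)]
    subst hy
    simp at h
    exact ha h
  have hexp : -(a / Real.sqrt (1 + b ^ 2)) ^ 2 * (1 + ((a * b + y * (1 + b ^ 2)) / a) ^ 2) / 2
      = -(y ^ 2 + (a + b * y) ^ 2) / 2 := by
    rw [hsq, hquad]
    field_simp
  rw [hexp, hquad]
  field_simp
  ring

lemma hasDerivAt_owenPrimitive {a y : ℝ} (b : ℝ) (ha : a ≠ 0) (hy : y ≠ 0) :
    HasDerivAt (owenPrimitive a b) (stdNormalPdf y * stdNormalCdf (a + b * y)) y := by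
  have hind : HasDerivAt (fun x : ℝ => (if a * x < 0 then (1 : ℝ) else 0)) 0 y := by
    have hcont : ContinuousAt (fun x : ℝ => a * x) y := by fun_prop
    rcases lt_or_gt_of_ne (mul_ne_zero ha hy) with h | h
    · refine (hasDerivAt_const y (1 : ℝ)).congr_of_eventuallyEq ?_
      filter_upwards [hcont.eventually_lt_const h] with x hx using if_pos hx
    · refine (hasDerivAt_const y (0 : ℝ)).congr_of_eventuallyEq ?_
      filter_upwards [hcont.eventually_const_lt h] with x hx using if_neg hx.not_gt
  have hquot : HasDerivAt (fun y => (a + b * y) / y) (-a / y ^ 2) y := by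
    refine ((hasDerivAt_affine a b y).fun_div (hasDerivAt_id' y) hy).congr_deriv ?_
    ring
  have hT := (hasDerivAt_id' y).owenT hquot
  have h := (((((hasDerivAt_stdNormalCdf y).div_const 2).add_const
    (stdNormalCdf (a / Real.sqrt (1 + b ^ 2)) / 2)).fun_sub (hind.div_const 2)).fun_sub
    hT).fun_sub (hasDerivAt_owenT_shift b y ha)
  refine h.congr_deriv ?_
  have hquad : 1 + ((a + b * y) / y) ^ 2 = (y ^ 2 + (a + b * y) ^ 2) / y ^ 2 := by
    field_simp
  have hexp : -y ^ 2 * (1 + ((a + b * y) / y) ^ 2) / 2 = -(y ^ 2 + (a + b * y) ^ 2) / 2 := by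
    rw [hquad]
    field_simp
  have hpos : y ^ 2 + (a + b * y) ^ 2 ≠ 0 := by positivity
  rw [hexp, hquad, div_mul_cancel₀ _ hy]
  field_simp
  ring

lemma hasDerivAt_reflectedOwenPrimitive {a b y : ℝ} (ha : a ≠ 0) (hc : a + b * y ≠ 0) :
    HasDerivAt (reflectedOwenPrimitive a b) (stdNormalPdf y * stdNormalCdf (a + b * y)) y := by
  have haff := hasDerivAt_affine a b y
  have hquot : HasDerivAt (fun y => y / (a + b * y)) (a / (a + b * y) ^ 2) y := by
    refine ((hasDerivAt_id' y).fun_div haff hc).congr_deriv ?_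
    ring
  have hΦ := (hasDerivAt_stdNormalCdf (a + b * y)).comp y haff
  have h := ((((hΦ.div_const 2).const_sub (stdNormalCdf (a / Real.sqrt (1 + b ^ 2)) / 2)).fun_add
    ((hasDerivAt_stdNormalCdf y).fun_mul hΦ)).fun_add
    (haff.owenT hquot)).fun_sub (hasDerivAt_owenT_shift b y ha)
  refine h.congr_deriv ?_
  have hpos : y ^ 2 + (a + b * y) ^ 2 ≠ 0 := by positivity
  have hquad : 1 + (y / (a + b * y)) ^ 2 = (y ^ 2 + (a + b * y) ^ 2) / (a + b * y) ^ 2 := by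
    rw [div_pow, one_add_div (pow_ne_zero 2 hc), add_comm]
  have hexp : -(a + b * y) ^ 2 * (1 + (y / (a + b * y)) ^ 2) / 2
      = -(y ^ 2 + (a + b * y) ^ 2) / 2 := by
    rw [hquad]
    field_simp
  rw [hexp, hquad, div_mul_cancel₀ _ hc]
  simp only [Function.comp_apply]
  generalize a + b * y = c at *
  field_simp
  ring

lemma owenPrimitive_eq_reflected {a b y : ℝ} (hy : y ≠ 0) (hc : 0 < a * (a + b * y)) :
    owenPrimitive a b y = reflectedOwenPrimitive a b y := by
  have ha : a ≠ 0 := left_ne_zero_of_mul hc.ne'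
  have hc0 : a + b * y ≠ 0 := right_ne_zero_of_mul hc.ne'
  have h := owenT_add_owenT_inv y (div_ne_zero hc0 hy)
  rw [div_mul_cancel₀ _ hy, inv_div] at h
  have hiff : (a + b * y) / y < 0 ↔ a * y < 0 := by
    rw [div_neg_iff, mul_neg_iff]
    rcases mul_pos_iff.1 hc with ⟨h1, h2⟩ | ⟨h1, h2⟩ <;>
      simp [h1, h2, h1.not_gt, h2.not_gt]
  simp only [hiff] at h
  rw [owenPrimitive, reflectedOwenPrimitive]
  linarith

lemma tendsto_owenPrimitive_atBot {a : ℝ} (b : ℝ) (ha : a ≠ 0) :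
    Tendsto (owenPrimitive a b) atBot (𝓝 0) := by
  have hb : 0 < 1 + b ^ 2 := by positivity
  set h := a / Real.sqrt (1 + b ^ 2) with hh
  set g : ℝ → ℝ := fun y => (a * b + y * (1 + b ^ 2)) / a with hg
  have hnum : Tendsto (fun y : ℝ => a * b + y * (1 + b ^ 2)) atBot atBot :=
    tendsto_atBot_add_const_left _ _ (tendsto_id.atBot_mul_const hb)
  have hu : Tendsto (fun y => g y * h) atBot atBot := by
    have := hnum.atBot_div_const (Real.sqrt_pos.2 hb)
    refine this.congr fun y => ?_
    simp only [hg, hh]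
    field_simp
  have hginv : Tendsto (fun y => (g y)⁻¹) atBot (𝓝 0) := by
    have := (tendsto_inv_atBot_zero.comp hnum).const_mul a
    simp only [mul_zero] at this
    refine this.congr fun y => ?_
    simp [hg, div_eq_mul_inv]
  have hT2 : Tendsto (fun y => owenT (g y * h) (g y)⁻¹) atBot (𝓝 0) := by
    refine squeeze_zero_norm (fun y => ?_) (by simpa only [abs_zero] using hginv.abs)
    refine (abs_owenT_le _ _).trans (mul_le_of_le_one_left (abs_nonneg _) ?_)
    rw [Real.exp_le_one_iff]
    linarith [sq_nonneg (g y * h)]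
  have hT1 : Tendsto (fun y => owenT y ((a + b * y) / y)) atBot (𝓝 0) := by
    have hq : Tendsto (fun y : ℝ => (a + b * y) / y) atBot (𝓝 b) := by
      have := (tendsto_inv_atBot_zero.const_mul a).add_const b
      rw [mul_zero, zero_add] at this
      refine this.congr' ?_
      filter_upwards [eventually_lt_atBot 0] with y hy
      field_simp [hy.ne]
    have hsq : Tendsto (fun y : ℝ => -y ^ 2 / 2) atBot atBot := by
      have h2 : Tendsto (fun y : ℝ => y ^ 2) atBot atTop :=
        (tendsto_pow_atTop (n := 2) (by norm_num)).comp tendsto_abs_atBot_atTop |>.congr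
          fun y => sq_abs y
      exact (tendsto_neg_atTop_atBot.comp h2).atBot_div_const two_pos
    have := (Real.tendsto_exp_atBot.comp hsq).mul hq.abs
    rw [zero_mul] at this
    exact squeeze_zero_norm (fun y => abs_owenT_le _ _) this
  have hlim : Tendsto (fun y => stdNormalCdf y / 2 - owenT y ((a + b * y) / y)
      - (stdNormalCdf (g y * h) / 2 - stdNormalCdf h * stdNormalCdf (g y * h))
      + owenT (g y * h) (g y)⁻¹) atBot (𝓝 0) := by
    have hΦu := tendsto_stdNormalCdf_atBot.comp hu
    have := (((tendsto_stdNormalCdf_atBot.div_const 2).sub hT1).sub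
      ((hΦu.div_const 2).sub (hΦu.const_mul (stdNormalCdf h)))).add hT2
    simpa using this
  refine hlim.congr' ?_
  filter_upwards [eventually_lt_atBot 0, hnum.eventually_lt_atBot 0] with y hy hy2
  have hg0 : g y ≠ 0 := div_ne_zero hy2.ne ha
  have hrefl := owenT_add_owenT_inv h hg0
  have hiff : g y < 0 ↔ a * y < 0 := by
    simp only [hg]
    rw [div_neg_iff, mul_neg_iff]
    simp [hy, hy2, hy.not_gt, hy2.not_gt]
  simp only [hiff] at hrefl
  rw [owenPrimitive, ← hh]
  simp only [hg] at hrefl ⊢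
  linarith

/-- Owen's closed form, continued through `y = 0`. -/
noncomputable def extendedOwenPrimitive (a b y : ℝ) : ℝ :=
  if y = 0 then reflectedOwenPrimitive a b y else owenPrimitive a b y

lemma hasDerivAt_extendedOwenPrimitive {a : ℝ} (b y : ℝ) (ha : a ≠ 0) :
    HasDerivAt (extendedOwenPrimitive a b) (stdNormalPdf y * stdNormalCdf (a + b * y)) y := by
  by_cases hy : y = 0
  · subst hy
    refine (hasDerivAt_reflectedOwenPrimitive ha (by simpa using ha)).congr_of_eventuallyEq ?_
    have hcont : ContinuousAt (fun y : ℝ => a * (a + b * y)) 0 := by fun_prop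
    filter_upwards [hcont.eventually_const_lt (u := 0) (by simpa using ha)] with x hx
    by_cases hx0 : x = 0
    · rw [extendedOwenPrimitive, if_pos hx0]
    · rw [extendedOwenPrimitive, if_neg hx0, owenPrimitive_eq_reflected hx0 hx]
  · refine (hasDerivAt_owenPrimitive b ha hy).congr_of_eventuallyEq ?_
    filter_upwards [eventually_ne_nhds hy] with x hx using if_neg hx

lemma tendsto_extendedOwenPrimitive_atBot {a : ℝ} (b : ℝ) (ha : a ≠ 0) :
    Tendsto (extendedOwenPrimitive a b) atBot (𝓝 0) := by
  refine (tendsto_owenPrimitive_atBot b ha).congr' ?_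
  filter_upwards [eventually_lt_atBot 0] with y hy using (if_neg hy.ne).symm

lemma integrable_stdNormalPdf_mul_stdNormalCdf (a b : ℝ) :
    Integrable fun x => stdNormalPdf x * stdNormalCdf (a + b * x) := by
  refine integrable_stdNormalPdf.mul_bdd (c := 1)
    (continuous_stdNormalCdf.comp (by fun_prop)).aestronglyMeasurable (ae_of_all _ fun x => ?_)
  rw [Real.norm_of_nonneg (stdNormalCdf_nonneg _)]
  exact stdNormalCdf_le_one _

lemma tnComposedErrorPdf_eq (μ t : ℝ) {σu σv : ℝ} (hσu : 0 < σu) (hσv : 0 < σv) :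
    tnComposedErrorPdf μ σu σv t = 1 / stdNormalCdf (μ / σu) *
      (stdNormalPdf ((t + μ) / Real.sqrt (σv ^ 2 + σu ^ 2)) *
        stdNormalCdf (μ * Real.sqrt (σv ^ 2 + σu ^ 2) / (σv * σu)
          + -(σu / σv) * ((t + μ) / Real.sqrt (σv ^ 2 + σu ^ 2))) *
        (1 / Real.sqrt (σv ^ 2 + σu ^ 2))) := by
  have hs : 0 < σv ^ 2 + σu ^ 2 := by positivity
  have harg : (μ * σv ^ 2 - t * σu ^ 2) / (Real.sqrt (σv ^ 2 + σu ^ 2) * σv * σu)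
      = μ * Real.sqrt (σv ^ 2 + σu ^ 2) / (σv * σu)
        + -(σu / σv) * ((t + μ) / Real.sqrt (σv ^ 2 + σu ^ 2)) := by
    have h2 := Real.sq_sqrt hs.le
    have h0 := Real.sqrt_pos.2 hs
    generalize Real.sqrt (σv ^ 2 + σu ^ 2) = s at *
    field_simp
    rw [h2]
    ring
  rw [tnComposedErrorPdf, harg, one_div_mul_eq_div]
  ring

theorem stmt1 (μ σu σv : ℝ) (hμ : μ ≠ 0) (hσu : 0 < σu) (hσv : 0 < σv)
    (a b : ℝ) (ha : a = μ * Real.sqrt (σv ^ 2 + σu ^ 2) / (σv * σu)) (hb : b = -(σu / σv))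
    (y : ℝ → ℝ) (hy : ∀ κ, y κ = (κ + μ) / Real.sqrt (σv ^ 2 + σu ^ 2))
    (κ : ℝ) (hκ : κ ≠ -μ) :
    (∫ t in Set.Iic κ, tnComposedErrorPdf μ σu σv t) =
      (1 / stdNormalCdf (μ / σu)) *
        ((1 / 2) * stdNormalCdf (y κ) + (1 / 2) * stdNormalCdf (a / Real.sqrt (1 + b ^ 2))
          - (1 / 2) * (if a / (y κ * Real.sqrt (1 + b ^ 2)) < 0 then 1 else 0)
          - owenT (y κ) ((a + b * y κ) / y κ)
          - owenT (a / Real.sqrt (1 + b ^ 2)) ((a * b + y κ * (1 + b ^ 2)) / a)) := by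
  have hs : 0 < Real.sqrt (σv ^ 2 + σu ^ 2) := Real.sqrt_pos.2 (by positivity)
  set s := Real.sqrt (σv ^ 2 + σu ^ 2)
  have ha0 : a ≠ 0 := by
    rw [ha]
    positivity
  have hpdf : ∀ t, tnComposedErrorPdf μ σu σv t = 1 / stdNormalCdf (μ / σu) *
      (stdNormalPdf (y t) * stdNormalCdf (a + b * y t) * (1 / s)) := fun t => by
    rw [tnComposedErrorPdf_eq μ t hσu hσv, hy t, ha, hb]
  have hyfun : y = fun t => (t + μ) / s := funext hy
  have hyderiv : ∀ t, HasDerivAt y (1 / s) t := fun t => by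
    rw [hyfun]
    exact ((hasDerivAt_id' t).add_const μ).div_const s
  have hybot : Tendsto y atBot atBot := by
    rw [hyfun]
    exact (tendsto_atBot_add_const_right _ μ tendsto_id).atBot_div_const hs
  have hint : Integrable fun t => stdNormalPdf (y t) * stdNormalCdf (a + b * y t) * (1 / s) := by
    rw [hyfun]
    exact ((((integrable_stdNormalPdf_mul_stdNormalCdf a b).comp_div hs.ne').comp_add_right
      μ)).mul_const _
  have hy0 : y κ ≠ 0 := by
    rw [hy]
    exact div_ne_zero (fun h => hκ (eq_neg_of_add_eq_zero_left h)) hs.ne'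
  simp_rw [hpdf]
  rw [integral_const_mul, integral_Iic_of_hasDerivAt_of_tendsto'
    (fun t _ => (hasDerivAt_extendedOwenPrimitive b (y t) ha0).comp t (hyderiv t))
    hint.integrableOn ((tendsto_extendedOwenPrimitive_atBot b ha0).comp hybot), sub_zero,
    Function.comp_apply, extendedOwenPrimitive, if_neg hy0, owenPrimitive]
  have hiff : a / (y κ * Real.sqrt (1 + b ^ 2)) < 0 ↔ a * y κ < 0 := by
    have hb : 0 < Real.sqrt (1 + b ^ 2) := Real.sqrt_pos.2 (by positivity)
    rw [← div_div, div_lt_iff₀ hb, zero_mul, div_neg_iff, mul_neg_iff]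
  simp only [hiff]
  ring
end

section
/- Let μ ∈ ℝ and σ_u, σ_v > 0, and set a = μ√(σ_v²+σ_u²)/(σ_v σ_u), b = −σ_u/σ_v, and ρ = −b/√(1+b²). Then for every κ ∈ ℝ, ∫_{−∞}^{κ} f(t) dt = (1/Φ(μ/σ_u)) · (1/(2π√(1−ρ²))) · ∫_{−∞}^{(κ+μ)/√(σ_v²+σ_u²)} ∫_{−∞}^{a/√(1+b²)} exp(−(r² − 2ρ r s + s²)/(2(1−ρ²))) dr ds, i.e. the composed error cdf equals (1/Φ(μ/σ_u)) times the cdf of a standard bivariate normal distribution with correlation ρ evaluated at (a/√(1+b²), (κ+μ)/√(σ_v²+σ_u²)), where f is the truncated-normal composed error density. -/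
open Real MeasureTheory

/-- Affine change of variables on a left half-line. -/
theorem integral_Iic_comp_sub_div (g : ℝ → ℝ) (κ m : ℝ) {c : ℝ} (hc : 0 < c) :
    ∫ t in Set.Iic κ, g ((t - m) / c) = c * ∫ s in Set.Iic ((κ - m) / c), g s := by
  have hind : (Set.Iic κ).indicator (fun t => g ((t - m) / c)) =
      fun t => (Set.Iic ((κ - m) / c)).indicator g ((t - m) / c) := by
    funext t
    by_cases ht : t ≤ κ
    · have h : (t - m) / c ≤ (κ - m) / c := by gcongr
      simp [Set.indicator, ht, h]
    · have h : ¬ (t - m) / c ≤ (κ - m) / c := by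
        rw [div_le_div_iff_of_pos_right hc]
        linarith
      simp [Set.indicator, ht, h]
  rw [← integral_indicator measurableSet_Iic, hind,
    integral_sub_right_eq_self (fun t => (Set.Iic ((κ - m) / c)).indicator g (t / c)) m,
    Measure.integral_comp_div, integral_indicator measurableSet_Iic, abs_of_pos hc, smul_eq_mul]

/-- Completing the square: the partial integral in one variable of the bivariate normal kernel
with correlation `ρ`. -/
theorem integral_Iic_bivariate_normal_kernel {ρ : ℝ} (hρ : 0 < 1 - ρ ^ 2) (A s : ℝ) :
    ∫ r in Set.Iic A, Real.exp (-(r ^ 2 - 2 * ρ * r * s + s ^ 2) / (2 * (1 - ρ ^ 2))) =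
      2 * Real.pi * Real.sqrt (1 - ρ ^ 2) *
        (stdNormalPdf s * stdNormalCdf ((A - ρ * s) / Real.sqrt (1 - ρ ^ 2))) := by
  have hτ : 0 < Real.sqrt (1 - ρ ^ 2) := Real.sqrt_pos.2 hρ
  have hτ2 : Real.sqrt (1 - ρ ^ 2) ^ 2 = 1 - ρ ^ 2 := Real.sq_sqrt hρ.le
  have hπ : 0 < Real.sqrt (2 * Real.pi) := Real.sqrt_pos.2 (by positivity)
  have hπ2 : Real.sqrt (2 * Real.pi) ^ 2 = 2 * Real.pi := Real.sq_sqrt (by positivity)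
  have hkernel : ∀ r, Real.exp (-(r ^ 2 - 2 * ρ * r * s + s ^ 2) / (2 * (1 - ρ ^ 2))) =
      2 * Real.pi * stdNormalPdf s * stdNormalPdf ((r - ρ * s) / Real.sqrt (1 - ρ ^ 2)) := by
    intro r
    have hexp : -(r ^ 2 - 2 * ρ * r * s + s ^ 2) / (2 * (1 - ρ ^ 2)) =
        -s ^ 2 / 2 + -((r - ρ * s) / Real.sqrt (1 - ρ ^ 2)) ^ 2 / 2 := by
      rw [div_pow, hτ2]
      field_simp
      ring
    rw [hexp, Real.exp_add, stdNormalPdf, stdNormalPdf]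
    field_simp
    rw [hπ2]
  simp_rw [hkernel]
  rw [integral_const_mul, integral_Iic_comp_sub_div stdNormalPdf A (ρ * s) hτ, stdNormalCdf]
  ring

theorem stmt2 (μ σu σv : ℝ) (hσu : 0 < σu) (hσv : 0 < σv)
    (a b ρ : ℝ) (ha : a = μ * Real.sqrt (σv ^ 2 + σu ^ 2) / (σv * σu)) (hb : b = -(σu / σv))
    (hρ : ρ = -b / Real.sqrt (1 + b ^ 2))
    (κ : ℝ) :
    (∫ t in Set.Iic κ, tnComposedErrorPdf μ σu σv t) =
      (1 / stdNormalCdf (μ / σu)) *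
        ((1 / (2 * Real.pi * Real.sqrt (1 - ρ ^ 2))) *
          ∫ s in Set.Iic ((κ + μ) / Real.sqrt (σv ^ 2 + σu ^ 2)),
            ∫ r in Set.Iic (a / Real.sqrt (1 + b ^ 2)),
              Real.exp (-(r ^ 2 - 2 * ρ * r * s + s ^ 2) / (2 * (1 - ρ ^ 2)))) := by
  set S := Real.sqrt (σv ^ 2 + σu ^ 2) with hSdef
  have hS : 0 < S := Real.sqrt_pos.2 (by positivity)
  have hS2 : S ^ 2 = σv ^ 2 + σu ^ 2 := Real.sq_sqrt (by positivity)
  have hb_sqrt : Real.sqrt (1 + b ^ 2) = S / σv := by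
    rw [Real.sqrt_eq_iff_eq_sq (by positivity) (by positivity), div_pow, hS2, hb]
    field_simp
  have hρS : ρ = σu / S := by
    rw [hρ, hb_sqrt, hb]
    field_simp
  have hρ2 : 1 - ρ ^ 2 = (σv / S) ^ 2 := by
    rw [hρS, div_pow, div_pow, one_sub_div (by positivity), hS2, add_sub_cancel_right]
  have hρ_pos : 0 < 1 - ρ ^ 2 := by
    rw [hρ2]
    positivity
  have hρ_sqrt : Real.sqrt (1 - ρ ^ 2) = σv / S := by
    rw [hρ2, Real.sqrt_sq (by positivity)]
  have hpdf : ∀ t, tnComposedErrorPdf μ σu σv t =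
      (fun s => 1 / (S * stdNormalCdf (μ / σu)) * (stdNormalPdf s *
        stdNormalCdf ((a / Real.sqrt (1 + b ^ 2) - ρ * s) / Real.sqrt (1 - ρ ^ 2))))
        ((t - -μ) / S) := by
    intro t
    have harg : (a / Real.sqrt (1 + b ^ 2) - ρ * ((t + μ) / S)) / Real.sqrt (1 - ρ ^ 2) =
        (μ * σv ^ 2 - t * σu ^ 2) / (S * σv * σu) := by
      rw [hρ_sqrt, hb_sqrt, hρS, ha]
      field_simp
      rw [hS2]
      ring
    simp only [sub_neg_eq_add]
    rw [harg, tnComposedErrorPdf, ← hSdef]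
    ring
  rw [funext hpdf, integral_Iic_comp_sub_div _ κ (-μ) hS, integral_const_mul, sub_neg_eq_add]
  simp_rw [integral_Iic_bivariate_normal_kernel hρ_pos]
  rw [integral_const_mul]
  have hτ : Real.sqrt (1 - ρ ^ 2) ≠ 0 := (Real.sqrt_pos.2 hρ_pos).ne'
  rw [← mul_assoc (1 / (2 * Real.pi * Real.sqrt (1 - ρ ^ 2))),
    one_div_mul_cancel (by positivity), one_mul, ← mul_assoc]
  congr 1
  rw [one_div, mul_inv, mul_inv_cancel_left₀ hS.ne', one_div]
end

section
/- Let λ > 0 and σ_v > 0, and set a = −λσ_v. Then for every κ ∈ ℝ, ∫_{−∞}^{κ} g(t) dt = −a · exp(−a²/2) · ∫_{−(κ+λσ_v²)/σ_v}^{∞} exp(a y) Φ(y) dy, where g is the exponential composed error density. -/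
open Real MeasureTheory

/-- Exponential composed error density. -/
noncomputable def expComposedErrorPdf (lam σv t : ℝ) : ℝ :=
  lam * Real.exp (lam * t + σv ^ 2 * lam ^ 2 / 2) * stdNormalCdf (-t / σv - lam * σv)

/-- The composed error density after the substitution `y = -t / σv - lam * σv`. -/
theorem expComposedErrorPdf_eq (lam σv t : ℝ) (hσv : σv ≠ 0) :
    expComposedErrorPdf lam σv t =
      lam * Real.exp (-(lam * σv) ^ 2 / 2) *
        (Real.exp (-(lam * σv) * (-t / σv - lam * σv)) *
          stdNormalCdf (-t / σv - lam * σv)) := by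
  have hexp : lam * t + σv ^ 2 * lam ^ 2 / 2 =
      -(lam * σv) ^ 2 / 2 + -(lam * σv) * (-t / σv - lam * σv) := by
    field_simp
    ring
  rw [expComposedErrorPdf, hexp, Real.exp_add]
  ring

/-- Change of variables along a decreasing affine map, from a left to a right half-line. -/
theorem setIntegral_Iic_comp_neg_div_sub (f : ℝ → ℝ) {s : ℝ} (hs : 0 < s) (b κ : ℝ) :
    ∫ t in Set.Iic κ, f (-t / s - b) = s * ∫ y in Set.Ici (-κ / s - b), f y := by
  have hind : (Set.Iic κ).indicator (fun t => f (-t / s - b)) =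
      fun t => (fun y => (Set.Ici (-κ / s - b)).indicator f (y - b)) (-s⁻¹ * t) := by
    ext t
    have hy : -s⁻¹ * t - b = -t / s - b := by ring
    have hmem : -t / s - b ∈ Set.Ici (-κ / s - b) ↔ t ∈ Set.Iic κ := by
      rw [Set.mem_Ici, Set.mem_Iic, sub_le_sub_iff_right, div_le_div_iff_of_pos_right hs,
        neg_le_neg_iff]
    simp only [hy, Set.indicator_apply, hmem]
  rw [← integral_indicator measurableSet_Iic, ← integral_indicator measurableSet_Ici, hind,
    Measure.integral_comp_mul_left, integral_sub_right_eq_self, inv_neg, inv_inv, abs_neg,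
    abs_of_pos hs, smul_eq_mul]

theorem stmt3 (lam σv : ℝ) (hlam : 0 < lam) (hσv : 0 < σv)
    (a : ℝ) (ha : a = -(lam * σv)) (κ : ℝ) :
    (∫ t in Set.Iic κ, expComposedErrorPdf lam σv t) =
      -a * Real.exp (-a ^ 2 / 2) *
        ∫ y in Set.Ici (-((κ + lam * σv ^ 2) / σv)), Real.exp (a * y) * stdNormalCdf y := by
  subst ha
  have hend : -((κ + lam * σv ^ 2) / σv) = -κ / σv - lam * σv := by
    field_simp
    ring
  simp only [fun t => expComposedErrorPdf_eq lam σv t hσv.ne']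
  rw [hend, integral_const_mul, setIntegral_Iic_comp_neg_div_sub
    (fun y => Real.exp (-(lam * σv) * y) * stdNormalCdf y) hσv, neg_neg, neg_sq]
  ring
end

section
/- Let μ ∈ ℝ and σ_u, σ_v > 0. Then for every κ ∈ ℝ, ∫_{0}^{∞} (1/σ_v) φ((κ + s)/σ_v) · (1/(σ_u Φ(μ/σ_u))) φ((s − μ)/σ_u) ds = (1/(√(σ_v²+σ_u²) Φ(μ/σ_u))) · φ((κ+μ)/√(σ_v²+σ_u²)) · Φ((μσ_v² − κσ_u²)/(√(σ_v²+σ_u²) σ_v σ_u)). In other words, the convolution density of ε = v − u, where v ~ N(0,σ_v²) and u follows a normal distribution N(μ,σ_u²) truncated to [0,∞), independent of v, equals the truncated-normal composed error density. -/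
open Real MeasureTheory

theorem stdNormalPdf_neg (x : ℝ) : stdNormalPdf (-x) = stdNormalPdf x := by
  simp [stdNormalPdf]

theorem integral_stdNormalPdf_sub_Ioi_zero (b : ℝ) :
    ∫ t in Set.Ioi (0 : ℝ), stdNormalPdf (t - b) = stdNormalCdf b := by
  have h := (measurePreserving_sub_right volume b).setIntegral_preimage_emb
    (measurableEmbedding_subRight b) stdNormalPdf (Set.Ioi (-b))
  rw [Set.preimage_sub_const_Ioi, neg_add_cancel] at h
  rw [h, ← integral_comp_neg_Iic]
  simp only [stdNormalPdf_neg, stdNormalCdf]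

theorem integral_stdNormalPdf_mul_sub_Ioi_zero {a : ℝ} (ha : 0 < a) (b : ℝ) :
    ∫ s in Set.Ioi (0 : ℝ), stdNormalPdf (a * s - b) = a⁻¹ * stdNormalCdf b := by
  rw [integral_comp_mul_left_Ioi (fun t => stdNormalPdf (t - b)) 0 ha, mul_zero,
    integral_stdNormalPdf_sub_Ioi_zero, smul_eq_mul]

/-- Completing the square in a product of two normal densities. -/
theorem stdNormalPdf_mul_stdNormalPdf {σu σv w : ℝ} (hσu : 0 < σu) (hσv : 0 < σv) (hw : 0 < w)
    (hw2 : w ^ 2 = σv ^ 2 + σu ^ 2) (μ κ s : ℝ) :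
    stdNormalPdf ((κ + s) / σv) * stdNormalPdf ((s - μ) / σu) =
      stdNormalPdf ((κ + μ) / w) *
        stdNormalPdf (w / (σv * σu) * s - (μ * σv ^ 2 - κ * σu ^ 2) / (w * σv * σu)) := by
  have hlin : w / (σv * σu) * s - (μ * σv ^ 2 - κ * σu ^ 2) / (w * σv * σu) =
      ((σv ^ 2 + σu ^ 2) * s - (μ * σv ^ 2 - κ * σu ^ 2)) / (w * σv * σu) := by
    rw [← hw2]
    field_simp
  have hpos : σv ^ 2 + σu ^ 2 ≠ 0 := by positivity
  simp only [stdNormalPdf, div_mul_div_comm, ← Real.exp_add]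
  rw [hlin]
  congr 2
  simp only [div_pow, mul_pow, hw2]
  field_simp
  ring

theorem stmt7 (μ σu σv : ℝ) (hσu : 0 < σu) (hσv : 0 < σv) (κ : ℝ) :
    (∫ s in Set.Ioi (0:ℝ),
        (1 / σv) * stdNormalPdf ((κ + s) / σv) *
          ((1 / (σu * stdNormalCdf (μ / σu))) * stdNormalPdf ((s - μ) / σu))) =
      (1 / (Real.sqrt (σv ^ 2 + σu ^ 2) * stdNormalCdf (μ / σu))) *
        stdNormalPdf ((κ + μ) / Real.sqrt (σv ^ 2 + σu ^ 2)) *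
        stdNormalCdf ((μ * σv ^ 2 - κ * σu ^ 2) / (Real.sqrt (σv ^ 2 + σu ^ 2) * σv * σu)) := by
  have hw : 0 < √(σv ^ 2 + σu ^ 2) := by positivity
  have hw2 : √(σv ^ 2 + σu ^ 2) ^ 2 = σv ^ 2 + σu ^ 2 := Real.sq_sqrt (by positivity)
  set w := √(σv ^ 2 + σu ^ 2)
  have hint (s : ℝ) : 1 / σv * stdNormalPdf ((κ + s) / σv) *
      (1 / (σu * stdNormalCdf (μ / σu)) * stdNormalPdf ((s - μ) / σu)) =
      1 / σv * (1 / (σu * stdNormalCdf (μ / σu))) * stdNormalPdf ((κ + μ) / w) *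
        stdNormalPdf (w / (σv * σu) * s - (μ * σv ^ 2 - κ * σu ^ 2) / (w * σv * σu)) := by
    rw [mul_mul_mul_comm, stdNormalPdf_mul_stdNormalPdf hσu hσv hw hw2]
    ring
  simp only [hint]
  rw [integral_const_mul, integral_stdNormalPdf_mul_sub_Ioi_zero (by positivity)]
  simp only [one_div, mul_inv, inv_div]
  field_simp
end

section
/- Let λ > 0 and σ_v > 0. Then for every κ ∈ ℝ, ∫_{0}^{∞} (1/σ_v) φ((κ + s)/σ_v) · λ exp(−λ s) ds = λ exp(λκ + σ_v²λ²/2) · Φ(−κ/σ_v − λσ_v). In other words, the convolution density of ε = v − u, where v ~ N(0,σ_v²) and u is exponentially distributed with rate λ, independent of v, equals the exponential composed error density. -/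
open Real MeasureTheory

theorem stdNormalCdf_neg (x : ℝ) : stdNormalCdf (-x) = ∫ t in Set.Ioi x, stdNormalPdf t := by
  rw [stdNormalCdf, ← integral_comp_neg_Ioi]
  simp_rw [stdNormalPdf_neg]

/-- Tilting a normal density by an exponential shifts its mean. -/
theorem stdNormalPdf_mul_exp (lam σ κ s : ℝ) (hσ : σ ≠ 0) :
    stdNormalPdf ((κ + s) / σ) * Real.exp (-(lam * s)) =
      Real.exp (lam * κ + σ ^ 2 * lam ^ 2 / 2) *
        stdNormalPdf (σ⁻¹ * s + (κ / σ + lam * σ)) := by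
  simp only [stdNormalPdf]
  rw [div_mul_eq_mul_div, ← mul_div_assoc, ← Real.exp_add, ← Real.exp_add]
  congr 2
  field_simp
  ring

theorem integral_Ioi_comp_add (f : ℝ → ℝ) (c : ℝ) :
    ∫ x in Set.Ioi (0 : ℝ), f (x + c) = ∫ x in Set.Ioi c, f x := by
  have h := (measurePreserving_add_right volume c).setIntegral_preimage_emb
    (measurableEmbedding_addRight c) f (Set.Ioi c)
  simpa using h

theorem stmt8 (lam σv : ℝ) (hlam : 0 < lam) (hσv : 0 < σv) (κ : ℝ) :
    (∫ s in Set.Ioi (0:ℝ),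
        (1 / σv) * stdNormalPdf ((κ + s) / σv) * (lam * Real.exp (-(lam * s)))) =
      lam * Real.exp (lam * κ + σv ^ 2 * lam ^ 2 / 2) *
        stdNormalCdf (-κ / σv - lam * σv) := by
  have hpt (s : ℝ) :
      (1 / σv) * stdNormalPdf ((κ + s) / σv) * (lam * Real.exp (-(lam * s))) =
        (1 / σv * lam * Real.exp (lam * κ + σv ^ 2 * lam ^ 2 / 2)) *
          stdNormalPdf (σv⁻¹ * s + (κ / σv + lam * σv)) := by
    linear_combination (1 / σv * lam) * stdNormalPdf_mul_exp lam σv κ s hσv.ne'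
  simp_rw [hpt]
  rw [integral_const_mul,
    integral_comp_mul_left_Ioi (fun y => stdNormalPdf (y + (κ / σv + lam * σv))) 0
      (inv_pos.2 hσv),
    mul_zero, integral_Ioi_comp_add, ← stdNormalCdf_neg, smul_eq_mul, inv_inv,
    show -κ / σv - lam * σv = -(κ / σv + lam * σv) by ring]
  field_simp
end

section
/- Let a, b ∈ ℝ with a ≠ 0, and set ρ = −b/√(1+b²). Then for every x ∈ ℝ, ∫_{−∞}^{x} φ(y) Φ(a + b y) dy = (1/(2π√(1−ρ²))) ∫_{−∞}^{x} ∫_{−∞}^{a/√(1+b²)} exp(−(r² − 2ρ r s + s²)/(2(1−ρ²))) dr ds. -/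
open Real MeasureTheory

/-- An increasing affine substitution in an integral over a left half-line. -/
theorem setIntegral_Iic_comp_mul_add {c : ℝ} (hc : 0 < c) (d u : ℝ) (f : ℝ → ℝ) :
    ∫ r in Set.Iic u, f (c * r + d) = c⁻¹ * ∫ t in Set.Iic (c * u + d), f t := by
  rw [← integral_indicator measurableSet_Iic, ← integral_indicator measurableSet_Iic]
  have h := Measure.integral_comp_mul_left
    (fun t => (Set.Iic (c * u + d)).indicator f (t + d)) c
  rw [integral_add_right_eq_self (fun t => (Set.Iic (c * u + d)).indicator f t) d,
    abs_of_pos (inv_pos.2 hc), smul_eq_mul] at h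
  rw [← h]
  congr 1
  ext r
  simp [Set.indicator_apply, mul_le_mul_iff_right₀ hc]

theorem stmt10 (a b : ℝ) (ha : a ≠ 0) (ρ : ℝ) (hρ : ρ = -b / Real.sqrt (1 + b ^ 2)) (x : ℝ) :
    (∫ y in Set.Iic x, stdNormalPdf y * stdNormalCdf (a + b * y)) =
      (1 / (2 * Real.pi * Real.sqrt (1 - ρ ^ 2))) *
        ∫ s in Set.Iic x, ∫ r in Set.Iic (a / Real.sqrt (1 + b ^ 2)),
          Real.exp (-(r ^ 2 - 2 * ρ * r * s + s ^ 2) / (2 * (1 - ρ ^ 2))) := by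
  have hc2 : √(1 + b ^ 2) ^ 2 = 1 + b ^ 2 := Real.sq_sqrt (by positivity)
  have hc : 0 < √(1 + b ^ 2) := Real.sqrt_pos.2 (by positivity)
  generalize √(1 + b ^ 2) = c at hρ hc hc2 ⊢
  have hvar : 1 - ρ ^ 2 = c⁻¹ ^ 2 := by
    rw [hρ]
    field_simp
    linarith
  rw [hvar, Real.sqrt_sq (inv_nonneg.2 hc.le), ← integral_const_mul]
  congr 1
  ext s
  have hexp (r : ℝ) : Real.exp (-(r ^ 2 - 2 * ρ * r * s + s ^ 2) / (2 * c⁻¹ ^ 2)) =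
      Real.exp (-s ^ 2 / 2) * Real.exp (-(c * r + b * s) ^ 2 / 2) := by
    rw [← Real.exp_add, hρ]
    congr 1
    field_simp
    linear_combination (-s ^ 2) * hc2
  simp_rw [hexp]
  rw [integral_const_mul,
    setIntegral_Iic_comp_mul_add hc (b * s) _ (fun t => Real.exp (-t ^ 2 / 2)),
    mul_div_cancel₀ _ hc.ne']
  simp only [stdNormalPdf, stdNormalCdf]
  rw [integral_div]
  have hpi : √(2 * π) ^ 2 = 2 * π := Real.sq_sqrt (by positivity)
  have hpi' : 0 < √(2 * π) := Real.sqrt_pos.2 (by positivity)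
  generalize √(2 * π) = k at hpi hpi' ⊢
  rw [← hpi]
  field_simp
end
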